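/- arXiv:2201.01023 — 3 statements merged into one kernel-verified Lean document; each statement's English description precedes it below -/
import Mathlib

section
/- Let (R,m,k) be a commutative Noetherian local ring, let X be a finitely generated R-module and let N be a Burch submodule of X. If M is a finitely generated R-module and t ≥ 1 is an integer such that Tor_t^R(M, N) = 0 and Tor_t^R(M, X/N) = 0, then the projective dimension of M is strictly less than t. -/
open CategoryTheory

universe u

/-- The colon submodule `(N :_X I) = {x ∈ X : I • x ⊆ N}`. -/
def Submodule.colonBy {R X : Type u} [CommRing R] [AddCommGroup X] [Module R X]
    (N : Submodule R X) (I : Ideal R) : Submodule R X where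
  carrier := {x | ∀ r ∈ I, r • x ∈ N}
  add_mem' := by
    intro a b ha hb r hr
    rw [smul_add]
    exact N.add_mem (ha r hr) (hb r hr)
  zero_mem' := by
    intro r hr
    rw [smul_zero]
    exact N.zero_mem
  smul_mem' := by
    intro c x hx r hr
    rw [smul_comm]
    exact N.smul_mem c (hx r hr)

/-- A submodule `N` of a module `X` over a local ring `(R, 𝔪)` is *Burch* if
`𝔪 • (N :_X 𝔪) ≠ 𝔪 • N`. -/
def Submodule.IsBurch {R X : Type u} [CommRing R] [IsLocalRing R] [AddCommGroup X]
    [Module R X] (N : Submodule R X) : Prop :=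
  IsLocalRing.maximalIdeal R • N.colonBy (IsLocalRing.maximalIdeal R) ≠
    IsLocalRing.maximalIdeal R • N

/-- `Tor_n^R(M, N) = 0`. -/
def TorIsZero (R : Type u) [CommRing R] (M N : Type u) [AddCommGroup M] [Module R M]
    [AddCommGroup N] [Module R N] (n : ℕ) : Prop :=
  Subsingleton (((Tor (ModuleCat.{u} R) n).obj (ModuleCat.of R M)).obj (ModuleCat.of R N))

/-- `Ext^n_R(M, N) = 0`. -/
def ExtIsZero (R : Type u) [CommRing R] (M N : Type u) [AddCommGroup M] [Module R M]
    [AddCommGroup N] [Module R N] (n : ℕ) : Prop :=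
  Subsingleton
    (((Ext R (ModuleCat.{u} R) n).obj (Opposite.op (ModuleCat.of R M))).obj (ModuleCat.of R N))

/-- `M` has projective dimension strictly less than `t`, i.e. `M` admits a projective
resolution vanishing in all degrees `≥ t`. -/
def HasProjDimLT (R : Type u) [CommRing R] (M : Type u) [AddCommGroup M] [Module R M]
    (t : ℕ) : Prop :=
  ∃ P : ProjectiveResolution (ModuleCat.of R M), ∀ i, t ≤ i → Limits.IsZero (P.complex.X i)

/-- `M` has injective dimension strictly less than `t`, i.e. `M` admits an injective
resolution vanishing in all degrees `≥ t`. -/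
def HasInjDimLT (R : Type u) [CommRing R] (M : Type u) [AddCommGroup M] [Module R M]
    (t : ℕ) : Prop :=
  ∃ I : InjectiveResolution (ModuleCat.of R M), ∀ i, t ≤ i → Limits.IsZero (I.cocomplex.X i)

/-- The depth of a module `M` over a local ring `(R, 𝔪, k)`: the smallest `i` such that
`Ext^i_R(k, M) ≠ 0` (and `⊤` if no such `i` exists). -/
noncomputable def moduleDepth (R : Type u) [CommRing R] [IsLocalRing R] (M : Type u)
    [AddCommGroup M] [Module R M] : ℕ∞ :=
  sInf {n : ℕ∞ | ∃ i : ℕ, n = (i : ℕ∞) ∧ ¬ ExtIsZero R (IsLocalRing.ResidueField R) M i}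

open MonoidalCategory Limits in
/-- Naturality, in the functor, of the comparison map out of the zeroth opcycles. -/
lemma CategoryTheory.ProjectiveResolution.opcyclesMap_comp_fromLeftDerivedZero'
    {C D : Type*} [Category* C] [Category* D] [Abelian C] [HasProjectiveResolutions C]
    [Abelian D] {Y : C} (P : ProjectiveResolution Y) {F G : C ⥤ D} [F.Additive] [G.Additive]
    (α : F ⟶ G) :
    HomologicalComplex.opcyclesMap
        ((NatTrans.mapHomologicalComplex α (ComplexShape.down ℕ)).app P.complex) 0 ≫
      P.fromLeftDerivedZero' G = P.fromLeftDerivedZero' F ≫ α.app Y := by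
  rw [← cancel_epi (HomologicalComplex.pOpcycles _ _)]
  simp only [HomologicalComplex.p_opcyclesMap_assoc,
    ProjectiveResolution.pOpcycles_comp_fromLeftDerivedZero',
    ProjectiveResolution.pOpcycles_comp_fromLeftDerivedZero'_assoc]
  exact (α.naturality (P.π.f 0)).symm

open Limits in
lemma CategoryTheory.ProjectiveResolution.mono_app_of_mono_homologyMap
    {C D : Type*} [Category* C] [Category* D] [Abelian C] [HasProjectiveResolutions C]
    [Abelian D] {Y : C} (P : ProjectiveResolution Y) {F G : C ⥤ D} [F.Additive] [G.Additive]
    [PreservesFiniteColimits F] [PreservesFiniteColimits G] (α : F ⟶ G)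
    [Mono (HomologicalComplex.homologyMap
      ((NatTrans.mapHomologicalComplex α (ComplexShape.down ℕ)).app P.complex) 0)] :
    Mono (α.app Y) := by
  have h₁ := P.opcyclesMap_comp_fromLeftDerivedZero' α
  have h₂ := HomologicalComplex.homologyι_naturality
    ((NatTrans.mapHomologicalComplex α (ComplexShape.down ℕ)).app P.complex) 0
  have h₃ : α.app Y = inv (P.fromLeftDerivedZero' F) ≫ (ChainComplex.isoHomologyι₀ _).inv ≫
      HomologicalComplex.homologyMap
        ((NatTrans.mapHomologicalComplex α (ComplexShape.down ℕ)).app P.complex) 0 ≫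
      (ChainComplex.isoHomologyι₀ _).hom ≫ P.fromLeftDerivedZero' G := by
    rw [IsIso.eq_inv_comp, Iso.eq_inv_comp, ← h₁]
    exact (Category.assoc _ _ _).symm.trans ((h₂ =≫ _).symm.trans (Category.assoc _ _ _))
  rw [h₃]
  infer_instance

namespace TorVanishing

open MonoidalCategory Limits

variable {R : Type u} [CommRing R]

/-- Tensoring a short complex of modules with a chain complex. -/
noncomputable def tensorShortComplex (S : ShortComplex (ModuleCat.{u} R))
    (K : ChainComplex (ModuleCat.{u} R) ℕ) :
    ShortComplex (ChainComplex (ModuleCat.{u} R) ℕ) where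
  X₁ := (((tensoringLeft _).obj S.X₁).mapHomologicalComplex _).obj K
  X₂ := (((tensoringLeft _).obj S.X₂).mapHomologicalComplex _).obj K
  X₃ := (((tensoringLeft _).obj S.X₃).mapHomologicalComplex _).obj K
  f := (NatTrans.mapHomologicalComplex ((tensoringLeft _).map S.f) _).app K
  g := (NatTrans.mapHomologicalComplex ((tensoringLeft _).map S.g) _).app K
  zero := by
    ext1 i
    change S.f ▷ K.X i ≫ S.g ▷ K.X i = 0
    rw [← comp_whiskerRight, S.zero, MonoidalPreadditive.zero_whiskerRight]

lemma tensorShortComplex_shortExact {S : ShortComplex (ModuleCat.{u} R)} (hS : S.ShortExact)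
    (K : ChainComplex (ModuleCat.{u} R) ℕ) [∀ i, Module.Flat R (K.X i)] :
    (tensorShortComplex S K).ShortExact :=
  HomologicalComplex.shortExact_of_degreewise_shortExact _ fun i =>
    hS.map_of_exact (tensorRight (K.X i))

instance (Y : ModuleCat.{u} R) (P : ProjectiveResolution Y) (i : ℕ) :
    Module.Flat R (P.complex.X i) := by
  have : Module.Projective R (P.complex.X i) :=
    (IsProjective.iff_projective _).2 (P.projective i)
  infer_instance

lemma isZero_tor_X₁ {S : ShortComplex (ModuleCat.{u} R)} (hS : S.ShortExact)
    (Y : ModuleCat.{u} R) (n : ℕ) (h₃ : IsZero (((Tor _ (n + 1)).obj S.X₃).obj Y))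
    (h₂ : IsZero (((Tor _ n).obj S.X₂).obj Y)) : IsZero (((Tor _ n).obj S.X₁).obj Y) := by
  let P := projectiveResolution Y
  have hK := tensorShortComplex_shortExact hS P.complex
  refine IsZero.of_iso ?_ (P.isoLeftDerivedObj ((tensoringLeft _).obj S.X₁) n)
  exact (hK.homology_exact₁ (n + 1) n (by simp)).isZero_of_both_zeros
    ((h₃.of_iso (P.isoLeftDerivedObj ((tensoringLeft _).obj S.X₃) (n + 1)).symm).eq_of_src _ _)
    ((h₂.of_iso (P.isoLeftDerivedObj ((tensoringLeft _).obj S.X₂) n).symm).eq_of_tgt _ _)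

lemma mono_whiskerRight_of_isZero_tor {S : ShortComplex (ModuleCat.{u} R)} (hS : S.ShortExact)
    (Y : ModuleCat.{u} R) (h₃ : IsZero (((Tor _ 1).obj S.X₃).obj Y)) :
    Mono (S.f ▷ Y) := by
  let P := projectiveResolution Y
  have hK := tensorShortComplex_shortExact hS P.complex
  have : Mono (HomologicalComplex.homologyMap
      ((NatTrans.mapHomologicalComplex ((tensoringLeft _).map S.f) _).app P.complex) 0) :=
    (hK.homology_exact₁ 1 0 (by simp)).mono_g
      ((h₃.of_iso (P.isoLeftDerivedObj ((tensoringLeft _).obj S.X₃) 1).symm).eq_of_src _ _)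
  have (Z : ModuleCat.{u} R) : PreservesFiniteColimits ((tensoringLeft _).obj Z) :=
    inferInstanceAs (PreservesFiniteColimits (tensorLeft Z))
  exact P.mono_app_of_mono_homologyMap ((tensoringLeft _).map S.f)

lemma isZero_tor_succ_of_flat (Y F : ModuleCat.{u} R) [Module.Flat R F] (n : ℕ) :
    IsZero (((Tor _ (n + 1)).obj F).obj Y) := by
  let P := projectiveResolution Y
  refine IsZero.of_iso ?_ (P.isoLeftDerivedObj ((tensoringLeft _).obj F) (n + 1))
  have := (Module.Flat.lTensor_shortComplex_exact F _ (P.exact_succ n))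
  refine (HomologicalComplex.exactAt_iff_isZero_homology _ _).1 ?_
  exact (HomologicalComplex.exactAt_iff' _ (n + 2) (n + 1) n (by simp) (by simp)).2 this

lemma torIsZero_iff_isZero {M N : Type u} [AddCommGroup M] [Module R M] [AddCommGroup N]
    [Module R N] {n : ℕ} : TorIsZero R M N n ↔
      IsZero (((Tor _ n).obj (ModuleCat.of R M)).obj (ModuleCat.of R N)) :=
  ModuleCat.isZero_iff_subsingleton.symm

variable {M F N : Type u} [AddCommGroup M] [Module R M] [AddCommGroup F] [Module R F]
  [AddCommGroup N] [Module R N] {f : F →ₗ[R] M}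

lemma rTensor_injective_of_torIsZero (hf : Function.Surjective f) (h : TorIsZero R M N 1) :
    Function.Injective ((LinearMap.ker f).subtype.rTensor N) :=
  (ModuleCat.mono_iff_injective _).1 (mono_whiskerRight_of_isZero_tor
    (LinearMap.shortExact_shortComplexKer hf) (ModuleCat.of R N) (torIsZero_iff_isZero.1 h))

lemma torIsZero_ker [Module.Flat R F] (hf : Function.Surjective f) {n : ℕ}
    (h : TorIsZero R M N (n + 2)) :
    TorIsZero R (LinearMap.ker f) N (n + 1) :=
  torIsZero_iff_isZero.2 (isZero_tor_X₁ (LinearMap.shortExact_shortComplexKer hf) _ _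
    (torIsZero_iff_isZero.1 h) (isZero_tor_succ_of_flat _ (ModuleCat.of R F) _))

end TorVanishing

section

open TensorProduct IsLocalRing

/-- A vector outside `𝔪 • ⊤` is sent to a nonzero element of the residue field by some linear
functional. -/
lemma IsLocalRing.exists_residueField_functional {R N : Type*} [CommRing R] [IsLocalRing R]
    [AddCommGroup N] [Module R N] {y : N} (hy : y ∉ maximalIdeal R • (⊤ : Submodule R N)) :
    ∃ φ : N →ₗ[R] ResidueField R, φ y ≠ 0 := by
  have h : (1 : ResidueField R) ⊗ₜ[R] y ≠ 0 := fun h => hy <| by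
    rw [← LinearMap.ker_tensorProductMk]
    exact h
  obtain ⟨f, hf⟩ : ∃ f : Module.Dual (ResidueField R) (ResidueField R ⊗[R] N),
      f ((1 : ResidueField R) ⊗ₜ[R] y) ≠ 0 := by
    by_contra! hf
    exact h ((Module.forall_dual_apply_eq_zero_iff _ _).1 hf)
  exact ⟨f.restrictScalars R ∘ₗ TensorProduct.mk R _ N 1, hf⟩

lemma Submodule.IsBurch.exists_smul_notMem {R X : Type u} [CommRing R] [IsLocalRing R]
    [AddCommGroup X] [Module R X] {N : Submodule R X} (hN : N.IsBurch) :
    ∃ x ∈ N.colonBy (maximalIdeal R), ∃ r ∈ maximalIdeal R, r • x ∉ maximalIdeal R • N := by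
  by_contra! h
  refine hN (le_antisymm (Submodule.smul_le.2 fun r hr x hx => h x hx r hr) ?_)
  exact Submodule.smul_mono le_rfl fun x hx r _ => N.smul_mem r hx

/-- A submodule of `𝔪F`, with `F` flat, is zero if tensoring its inclusion with `N` and `X ⧸ N`
preserves injectivity for some Burch submodule `N` of `X`. -/
lemma Submodule.IsBurch.eq_bot_of_rTensor_injective {R X F : Type u} [CommRing R] [IsLocalRing R]
    [AddCommGroup X] [Module R X] {N : Submodule R X} (hN : N.IsBurch)
    [AddCommGroup F] [Module R F] [Module.Flat R F] (L : Submodule R F) [Module.Finite R L]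
    (hL : L ≤ maximalIdeal R • ⊤)
    (h₁ : Function.Injective (L.subtype.rTensor N))
    (h₂ : Function.Injective (L.subtype.rTensor (X ⧸ N))) : L = ⊥ := by
  obtain ⟨x, hx, r, hr, hrx⟩ := hN.exists_smul_notMem
  obtain ⟨φ, hφ⟩ := exists_residueField_functional
    (y := (⟨r • x, hx r hr⟩ : N)) (fun h => hrx <| by
      have := Submodule.mem_map_of_mem (f := N.subtype) h
      simpa [Submodule.map_smul''] using this)
  have hzero (e : L) : e ⊗ₜ[R] N.mkQ x = 0 := by
    apply h₂
    rw [map_zero, LinearMap.rTensor_tmul, Submodule.subtype_apply]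
    refine Submodule.smul_induction_on (p := fun f => f ⊗ₜ[R] N.mkQ x = 0) (hL e.2) ?_ ?_
    · intro a ha f _
      have hax : N.mkQ (a • x) = 0 := (Submodule.Quotient.mk_eq_zero N).2 (hx a ha)
      rw [smul_tmul, ← map_smul, hax, tmul_zero]
    · intro f g hf hg
      rw [add_tmul, hf, hg, add_zero]
  have htmul (e : L) : φ ⟨r • x, hx r hr⟩ ⊗ₜ[R] e = 0 := by
    obtain ⟨n, hn⟩ := (lTensor_exact L (LinearMap.exact_subtype_mkQ N)
      N.mkQ_surjective (e ⊗ₜ[R] x)).1 (hzero e)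
    have heq : e ⊗ₜ[R] (⟨r • x, hx r hr⟩ : N) = r • n := by
      apply h₁
      apply Module.Flat.lTensor_preserves_injective_linearMap (M := F) N.subtype
        N.injective_subtype
      have hcomm (z : L ⊗[R] N) : N.subtype.lTensor F (L.subtype.rTensor N z) =
          L.subtype.rTensor X (N.subtype.lTensor L z) := by
        rw [← LinearMap.comp_apply, ← LinearMap.comp_apply, LinearMap.lTensor_comp_rTensor,
          LinearMap.rTensor_comp_lTensor]
      rw [hcomm, hcomm, map_smul, hn]
      simp
    have := congr_arg ((TensorProduct.comm R L (ResidueField R)).toLinearMap ∘ₗ φ.lTensor L) heq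
    rw [map_smul] at this
    have hkill (z : ResidueField R ⊗[R] L) : r • z = 0 := by
      rw [← algebraMap_smul (ResidueField R) r z, ResidueField.algebraMap_eq,
        (residue_eq_zero_iff r).2 hr, zero_smul]
    rw [hkill] at this
    simpa using this
  have : Subsingleton (ResidueField R ⊗[R] L) := by
    refine subsingleton_of_forall_eq 0 fun z => ?_
    induction z with
    | zero => rfl
    | add a b ha hb => rw [ha, hb, add_zero]
    | tmul c e =>
      have := congr_arg ((c / φ ⟨r • x, hx r hr⟩) • ·) (htmul e)
      simpa [smul_tmul', hφ] using this
  rw [← Submodule.subsingleton_iff_eq_bot]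
  exact subsingleton_tensorProduct.1 this

lemma IsLocalRing.exists_minimal_presentation (R : Type u) [CommRing R] [IsLocalRing R]
    (M : Type u) [AddCommGroup M] [Module R M] [Module.Finite R M] :
    ∃ (n : ℕ) (f : (Fin n → R) →ₗ[R] M), Function.Surjective f ∧
      LinearMap.ker f ≤ maximalIdeal R • ⊤ := by
  let w := Module.finBasis (ResidueField R) (ResidueField R ⊗[R] M)
  obtain ⟨v, hv⟩ := (TensorProduct.mk_surjective R M (ResidueField R)
    Ideal.Quotient.mk_surjective).comp_left w
  refine ⟨_, Fintype.linearCombination R v, ?_, fun a ha => ?_⟩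
  · rw [← LinearMap.range_eq_top, Fintype.range_linearCombination]
    exact span_eq_top_of_tmul_eq_basis v w (congr_fun hv)
  · have h : ∑ i, residue R (a i) • w i = 0 := by
      rw [LinearMap.mem_ker, Fintype.linearCombination_apply] at ha
      have := congr_arg (TensorProduct.mk R (ResidueField R) M 1) ha
      simp only [map_sum, map_smul, map_zero] at this
      rw [← this, ← hv]
      refine Finset.sum_congr rfl fun i _ => ?_
      exact algebraMap_smul (ResidueField R) (a i) _
    have h0 := Fintype.linearIndependent_iff.1 w.linearIndependent _ h
    rw [← (Pi.basisFun R _).sum_repr a]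
    exact Submodule.sum_mem _ fun i _ => Submodule.smul_mem_smul
      ((residue_eq_zero_iff _).1 (h0 i)) trivial

end

section

open Limits

variable {C : Type*} [Category* C] [Abelian C]

/-- Splicing a projective resolution of the kernel of an epimorphism from a projective object. -/
noncomputable def CategoryTheory.ProjectiveResolution.augment {S : ShortComplex C}
    (hS : S.ShortExact) [Projective S.X₂] (P : ProjectiveResolution S.X₁) :
    ProjectiveResolution S.X₃ :=
  have := hS.mono_f
  have := hS.epi_g
  let p : P.complex.X 0 ⟶ S.X₁ := P.π.f 0
  have hp : Epi p := inferInstanceAs (Epi (P.π.f 0))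
  have hd : P.complex.d 1 0 ≫ p = 0 := P.complex_d_comp_π_f_zero
  have hex : (ShortComplex.mk _ _ hd).Exact := P.exact₀
  have w : P.complex.d 1 0 ≫ p ≫ S.f = 0 := by rw [← Category.assoc, hd, zero_comp]
  have w' : (p ≫ S.f) ≫ S.g = 0 := by rw [Category.assoc, S.zero, comp_zero]
  let K := P.complex.augment (p ≫ S.f) w
  have hπ : ((K.toSingle₀Equiv S.X₃).symm ⟨S.g, w'⟩).f 0 = S.g :=
    ChainComplex.toSingle₀Equiv_symm_apply_f_zero (C := K) S.g w'
  { complex := K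
    projective
      | 0 => inferInstanceAs (Projective S.X₂)
      | i + 1 => P.projective i
    π := (K.toSingle₀Equiv S.X₃).symm ⟨S.g, w'⟩
    quasiIso := ⟨fun n => by
      match n with
      | 0 =>
        rw [ChainComplex.quasiIsoAt₀_iff, ShortComplex.quasiIso_iff_of_zeros']
        · have : (ShortComplex.mk _ _ w').Exact ∧ Epi S.g := by
            let φ : ShortComplex.mk _ _ w' ⟶ S := { τ₁ := p, τ₂ := 𝟙 _, τ₃ := 𝟙 _ }
            exact ⟨(ShortComplex.exact_iff_of_epi_of_isIso_of_mono φ).2 hS.exact, inferInstance⟩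
          refine (ShortComplex.exact_and_epi_g_iff_of_iso ?_).2 this
          exact ShortComplex.isoMk (Iso.refl _) (Iso.refl _) (Iso.refl _)
            ((Category.id_comp _).trans (Category.comp_id _).symm)
            ((Category.id_comp S.g).trans (hπ.symm.trans (Category.comp_id _).symm))
        all_goals rfl
      | 1 =>
        rw [quasiIsoAt_iff_exactAt' _ _ (ChainComplex.exactAt_succ_single_obj _ _),
          HomologicalComplex.exactAt_iff' _ 2 1 0 (by simp) (by simp)]
        let φ : ShortComplex.mk _ _ hd ⟶ ShortComplex.mk _ _ w :=
          { τ₁ := 𝟙 _, τ₂ := 𝟙 _, τ₃ := S.f }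
        exact (ShortComplex.exact_iff_of_epi_of_isIso_of_mono φ).1 hex
      | n + 2 =>
        rw [quasiIsoAt_iff_exactAt' _ _ (ChainComplex.exactAt_succ_single_obj _ _),
          HomologicalComplex.exactAt_iff' _ (n + 3) (n + 2) (n + 1) (by simp) (by simp)]
        exact P.exact_succ n⟩ }

end

lemma HasProjDimLT.of_shortExact {R : Type u} [CommRing R] {S : ShortComplex (ModuleCat.{u} R)}
    (hS : S.ShortExact) [Projective S.X₂] {t : ℕ} (h : HasProjDimLT R S.X₁ t) :
    HasProjDimLT R S.X₃ (t + 1) := by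
  obtain ⟨P, hP⟩ := h
  refine ⟨ProjectiveResolution.augment hS P, fun i hi => ?_⟩
  match i, hi with
  | i + 1, hi => exact hP i (Nat.le_of_succ_le_succ hi)

lemma HasProjDimLT.of_subsingleton {R : Type u} [CommRing R] (M : Type u)
    [AddCommGroup M] [Module R M] [Subsingleton M] : HasProjDimLT R M 0 := by
  have hM := ModuleCat.isZero_of_subsingleton (ModuleCat.of R M)
  have := hM.projective
  refine ⟨ProjectiveResolution.self _, fun i _ => ?_⟩
  match i with
  | 0 => exact hM
  | i + 1 => exact HomologicalComplex.isZero_single_obj_X _ _ _ _ (by simp)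

/-- Over a Noetherian local ring, if `N` is a Burch submodule of a finitely
generated module `X`, `M` is finitely generated, `t ≥ 1`, and
`Tor_t^R(M, N) = Tor_t^R(M, X/N) = 0`, then `pd_R M < t`. -/
theorem burch_tor_sub_and_quotient_vanishing
    {R : Type u} [CommRing R] [IsNoetherianRing R] [IsLocalRing R]
    {X : Type u} [AddCommGroup X] [Module R X] [Module.Finite R X]
    (N : Submodule R X) (hN : N.IsBurch)
    {M : Type u} [AddCommGroup M] [Module R M] [Module.Finite R M]
    (t : ℕ) (ht : 1 ≤ t)
    (h1 : TorIsZero R M (↥N) t) (h2 : TorIsZero R M (X ⧸ N) t) :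
    HasProjDimLT R M t := by
  obtain ⟨t, rfl⟩ := Nat.exists_eq_add_of_le' ht
  clear ht
  induction t generalizing M with
  | zero =>
    obtain ⟨n, f, hf, hker⟩ := IsLocalRing.exists_minimal_presentation R M
    have hS := LinearMap.shortExact_shortComplexKer hf
    have hL := hN.eq_bot_of_rTensor_injective (LinearMap.ker f) hker
      (TorVanishing.rTensor_injective_of_torIsZero hf h1)
      (TorVanishing.rTensor_injective_of_torIsZero hf h2)
    have : Subsingleton (LinearMap.ker f) := (Submodule.subsingleton_iff_eq_bot).2 hL
    exact .of_shortExact hS (.of_subsingleton _)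
  | succ t ih =>
    obtain ⟨n, f, hf⟩ := Module.Finite.exists_fin' R M
    have hS := LinearMap.shortExact_shortComplexKer hf
    exact .of_shortExact hS (ih (TorVanishing.torIsZero_ker hf h1)
      (TorVanishing.torIsZero_ker hf h2))
end

section
/- Let (R,m,k) be a commutative Noetherian local ring, let X be a finitely generated R-module and let N be a Burch submodule of X. If M is a finitely generated R-module and t ≥ 1 is an integer such that Tor_{t-1}^R(M, N) = 0 and Tor_t^R(M, N) = 0, then the projective dimension of M is strictly less than t. -/
open CategoryTheory

universe u

open TensorProduct

lemma Submodule.IsBurch.exists_eq_smul_notMem {R X : Type u} [CommRing R] [IsLocalRing R]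
    [AddCommGroup X] [Module R X] {N : Submodule R X} (hN : N.IsBurch) :
    ∃ a ∈ IsLocalRing.maximalIdeal R, ∃ x ∈ N.colonBy (IsLocalRing.maximalIdeal R),
      ∃ y : N, (y : X) = a • x ∧ y ∉ IsLocalRing.maximalIdeal R • (⊤ : Submodule R N) := by
  by_contra! h
  refine hN (le_antisymm (Submodule.smul_le.mpr fun a ha x hx ↦ ?_)
    (Submodule.smul_mono le_rfl fun x hx r _ ↦ N.smul_mem r hx))
  have := Submodule.mem_map_of_mem (f := N.subtype) (h a ha x hx ⟨a • x, hx a ha⟩ rfl)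
  rwa [Submodule.map_smul'', Submodule.map_subtype_top] at this

namespace IsLocalRing

variable {R : Type u} [CommRing R] [IsLocalRing R] {P Q : Type u} [AddCommGroup P] [Module R P]
  [AddCommGroup Q] [Module R Q]

lemma one_tmul_eq_zero_iff (e : P) :
    (1 : ResidueField R) ⊗ₜ[R] e = 0 ↔ e ∈ maximalIdeal R • (⊤ : Submodule R P) := by
  have := TensorProduct.quotTensorEquivQuotSMul_mk_tmul (M := P) (maximalIdeal R) 1 e
  rw [one_smul] at this
  rw [← Submodule.Quotient.mk_eq_zero, ← this]
  exact (TensorProduct.quotTensorEquivQuotSMul P (maximalIdeal R)).map_eq_zero_iff.symm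

lemma exists_linearMap_residueField_ne_zero {e : P}
    (he : e ∉ maximalIdeal R • (⊤ : Submodule R P)) :
    ∃ φ : P →ₗ[R] ResidueField R, φ e ≠ 0 := by
  rw [← one_tmul_eq_zero_iff, ← Module.forall_dual_apply_eq_zero_iff (ResidueField R)] at he
  push Not at he
  obtain ⟨φ, hφ⟩ := he
  exact ⟨φ.restrictScalars R ∘ₗ TensorProduct.mk R (ResidueField R) P 1, hφ⟩

lemma mem_or_mem_of_tmul_mem_smul_top {e : P} {q : Q}
    (h : e ⊗ₜ[R] q ∈ maximalIdeal R • (⊤ : Submodule R (P ⊗[R] Q))) :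
    e ∈ maximalIdeal R • (⊤ : Submodule R P) ∨ q ∈ maximalIdeal R • (⊤ : Submodule R Q) := by
  by_contra! hc
  obtain ⟨φ, hφ⟩ := exists_linearMap_residueField_ne_zero hc.1
  obtain ⟨ψ, hψ⟩ := exists_linearMap_residueField_ne_zero hc.2
  let χ : P ⊗[R] Q →ₗ[R] ResidueField R := LinearMap.mul' R _ ∘ₗ TensorProduct.map φ ψ
  have hle : maximalIdeal R • (⊤ : Submodule R (P ⊗[R] Q)) ≤ LinearMap.ker χ := by
    refine Submodule.smul_le.mpr fun r hr z _ ↦ ?_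
    rw [LinearMap.mem_ker, map_smul, Algebra.smul_def, ResidueField.algebraMap_eq,
      (residue_eq_zero_iff r).mpr hr, zero_mul]
  exact mul_ne_zero hφ hψ (hle h)

end IsLocalRing

open IsLocalRing in
/-- Given a two-step presentation `L₂ → F₁ → F₀` with flat terms in which the syzygies stay
injective after tensoring with a Burch submodule, the first syzygy `L` is free. -/
lemma Submodule.IsBurch.free_of_rTensor_injective
    {R X L₂ F₁ L F₀ : Type u} [CommRing R] [IsLocalRing R]
    [AddCommGroup X] [Module R X] {N : Submodule R X} (hN : N.IsBurch)
    [AddCommGroup L₂] [Module R L₂] [AddCommGroup F₁] [Module R F₁]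
    [AddCommGroup L] [Module R L] [AddCommGroup F₀] [Module R F₀]
    [Module.Finite R L₂] [Module.Finite R F₁] [Module.Free R F₁] [Module.Flat R F₀]
    {f : L₂ →ₗ[R] F₁} {g : F₁ →ₗ[R] L} {h : L →ₗ[R] F₀}
    (hfg : Function.Exact f g) (hg : Function.Surjective g)
    (hfN : Function.Injective (f.rTensor N)) (hhN : Function.Injective (h.rTensor N)) :
    Module.Free R L := by
  obtain ⟨a, ha, x, hx, n, hn, hnm⟩ := hN.exists_eq_smul_notMem
  refine Module.free_of_lTensor_residueField_injective f g hg hfg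
    ((injective_iff_map_eq_zero _).mpr fun z hz ↦ ?_)
  obtain ⟨e, rfl⟩ := TensorProduct.mk_surjective R L₂ (ResidueField R) residue_surjective z
  rw [TensorProduct.mk_apply, LinearMap.lTensor_tmul, one_tmul_eq_zero_iff] at hz
  rw [TensorProduct.mk_apply, one_tmul_eq_zero_iff]
  obtain ⟨w, hw⟩ : f e ⊗ₜ[R] x ∈ LinearMap.range (N.subtype.lTensor F₁) := by
    refine Submodule.smul_induction_on hz (fun r hr v _ ↦ ?_) (fun u v hu hv ↦ ?_)
    · exact ⟨v ⊗ₜ ⟨r • x, hx r hr⟩, by simp [TensorProduct.smul_tmul]⟩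
    · rw [TensorProduct.add_tmul]
      exact add_mem hu hv
  have hgw : g.rTensor N w = 0 := by
    refine hhN (Module.Flat.lTensor_preserves_injective_linearMap (M := F₀) N.subtype
      N.subtype_injective ?_)
    rw [map_zero, map_zero, ← LinearMap.comp_apply (h.rTensor N), ← LinearMap.rTensor_comp,
      ← LinearMap.comp_apply, LinearMap.lTensor_comp_rTensor, ← LinearMap.rTensor_comp_lTensor,
      LinearMap.comp_apply, hw, LinearMap.rTensor_tmul, LinearMap.comp_apply,
      hfg.apply_apply_eq_zero, map_zero, TensorProduct.zero_tmul]
  obtain ⟨y, rfl⟩ := (rTensor_exact N hfg hg w).mp hgw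
  have hay : e ⊗ₜ[R] n = a • y := by
    refine hfN (Module.Flat.lTensor_preserves_injective_linearMap (M := F₁) N.subtype
      N.subtype_injective ?_)
    rw [map_smul, map_smul, hw]
    simp [hn]
  refine (mem_or_mem_of_tmul_mem_smul_top (q := n) ?_).resolve_right hnm
  rw [hay]
  exact Submodule.smul_mem_smul ha trivial

lemma Submodule.IsBurch.subsingleton_of_tensorProduct {R X M : Type u} [CommRing R]
    [IsLocalRing R] [AddCommGroup X] [Module R X] {N : Submodule R X} (hN : N.IsBurch)
    [AddCommGroup M] [Module R M] [Module.Finite R M] [Subsingleton (M ⊗[R] N)] :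
    Subsingleton M := by
  obtain ⟨a, ha, x, hx, n, hn, hnm⟩ := hN.exists_eq_smul_notMem
  rw [← Submodule.subsingleton_iff R, ← subsingleton_iff_bot_eq_top, eq_comm]
  refine Submodule.eq_bot_of_le_smul_of_le_jacobson_bot (IsLocalRing.maximalIdeal R) _
    Module.Finite.fg_top (fun e _ ↦ ?_) (IsLocalRing.maximalIdeal_le_jacobson _)
  refine (IsLocalRing.mem_or_mem_of_tmul_mem_smul_top ?_).resolve_right hnm
  rw [Subsingleton.elim (e ⊗ₜ[R] _) 0]
  exact zero_mem _

/-- Being a monomorphism transfers along a commutative square with invertible sides. -/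
lemma CategoryTheory.mono_of_comm_isIso {C : Type*} [Category* C] {W X Y Z : C} {f : W ⟶ X}
    {g : Y ⟶ Z} {a : W ⟶ Y} {b : X ⟶ Z} [IsIso a] [IsIso b] [Mono f] (h : f ≫ b = a ≫ g) :
    Mono g := by
  rw [show g = inv a ≫ f ≫ b from (IsIso.eq_inv_comp a).mpr h.symm]
  infer_instance

namespace CategoryTheory.ProjectiveResolution

open Limits

variable {C : Type*} [Category* C] [Abelian C]

/-- The augmentation of a projective resolution, as a morphism to the resolved object. -/
noncomputable def augmentation {X : C} (P : ProjectiveResolution X) : P.complex.X 0 ⟶ X :=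
  P.π.f 0

instance {X : C} (P : ProjectiveResolution X) : Epi P.augmentation :=
  inferInstanceAs (Epi (P.π.f 0))

lemma complex_d_comp_augmentation {X : C} (P : ProjectiveResolution X) :
    P.complex.d 1 0 ≫ P.augmentation = 0 :=
  P.complex_d_comp_π_f_zero

lemma complex_d_comp_augmentation_comp {X Y : C} (P : ProjectiveResolution X) (f : X ⟶ Y) :
    P.complex.d 1 0 ≫ P.augmentation ≫ f = 0 := by
  rw [← Category.assoc, complex_d_comp_augmentation, zero_comp]

/-- The complex obtained by splicing a projective resolution of `S.X₁` with `S`. -/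
noncomputable abbrev spliceComplex (S : ShortComplex C) (P : ProjectiveResolution S.X₁) :
    ChainComplex C ℕ :=
  P.complex.augment (P.augmentation ≫ S.f) (P.complex_d_comp_augmentation_comp S.f)

instance projective_spliceComplex_X (S : ShortComplex C) [Projective S.X₂]
    (P : ProjectiveResolution S.X₁) (n : ℕ) : Projective ((spliceComplex S P).X n) :=
  match n with
  | 0 => inferInstanceAs (Projective S.X₂)
  | n + 1 => inferInstanceAs (Projective (P.complex.X n))

lemma spliceComplex_exact_zero {S : ShortComplex C} (hS : S.ShortExact)
    (P : ProjectiveResolution S.X₁) :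
    (ShortComplex.mk (P.augmentation ≫ S.f) S.g (by rw [Category.assoc, S.zero, comp_zero])).Exact := by
  let α : ShortComplex.mk (P.augmentation ≫ S.f) S.g
      (by rw [Category.assoc, S.zero, comp_zero]) ⟶ S :=
    { τ₁ := P.augmentation
      τ₂ := 𝟙 _
      τ₃ := 𝟙 _ }
  have : Epi α.τ₁ := inferInstanceAs (Epi P.augmentation)
  have : IsIso α.τ₂ := inferInstanceAs (IsIso (𝟙 _))
  have : Mono α.τ₃ := inferInstanceAs (Mono (𝟙 _))
  exact (ShortComplex.exact_iff_of_epi_of_isIso_of_mono α).mpr hS.exact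

lemma spliceComplex_exact_one {S : ShortComplex C} (hS : S.ShortExact)
    (P : ProjectiveResolution S.X₁) :
    (ShortComplex.mk (P.complex.d 1 0) (P.augmentation ≫ S.f)
      (P.complex_d_comp_augmentation_comp S.f)).Exact := by
  have := hS.mono_f
  let α : ShortComplex.mk (P.complex.d 1 0) (P.augmentation) P.complex_d_comp_augmentation ⟶
      ShortComplex.mk (P.complex.d 1 0) (P.augmentation ≫ S.f)
        (P.complex_d_comp_augmentation_comp S.f) :=
    { τ₁ := 𝟙 _
      τ₂ := 𝟙 _
      τ₃ := S.f }
  have : Epi α.τ₁ := inferInstanceAs (Epi (𝟙 _))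
  have : IsIso α.τ₂ := inferInstanceAs (IsIso (𝟙 _))
  have : Mono α.τ₃ := inferInstanceAs (Mono S.f)
  exact (ShortComplex.exact_iff_of_epi_of_isIso_of_mono α).mp P.exact₀

lemma spliceComplex_exactAt_succ {S : ShortComplex C} (hS : S.ShortExact)
    (P : ProjectiveResolution S.X₁) (n : ℕ) : (spliceComplex S P).ExactAt (n + 1) := by
  rw [HomologicalComplex.exactAt_iff' _ (n + 1 + 1) (n + 1) n (by simp) (by simp)]
  match n with
  | 0 => exact spliceComplex_exact_one hS P
  | n + 1 => exact P.exact_succ n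

/-- Splicing a projective resolution of the kernel of an epimorphism `F ⟶ M` from a projective
object gives a projective resolution of `M`. -/
noncomputable def splice {S : ShortComplex C} (hS : S.ShortExact) [Projective S.X₂]
    (P : ProjectiveResolution S.X₁) : ProjectiveResolution S.X₃ where
  complex := spliceComplex S P
  π := (ChainComplex.toSingle₀Equiv _ _).symm ⟨S.g, by
    change (P.augmentation ≫ S.f) ≫ S.g = 0
    rw [Category.assoc, S.zero, comp_zero]⟩
  quasiIso := ⟨fun n ↦ by
    have := hS.epi_g
    match n with
    | 0 =>
      rw [ChainComplex.quasiIsoAt₀_iff, ShortComplex.quasiIso_iff_of_zeros']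
      · dsimp
        refine (ShortComplex.exact_and_epi_g_iff_of_iso ?_).2
          ⟨spliceComplex_exact_zero hS P, hS.epi_g⟩
        exact ShortComplex.isoMk (Iso.refl _) (Iso.refl _) (Iso.refl _)
          ((Category.id_comp _).trans (Category.comp_id _).symm)
          ((Category.id_comp _).trans (.trans
            (ChainComplex.toSingle₀Equiv_symm_apply_f_zero
              (C := spliceComplex S P) S.g _).symm (Category.comp_id _).symm))
      all_goals rfl
    | n + 1 =>
      rw [quasiIsoAt_iff_exactAt']
      · exact spliceComplex_exactAt_succ hS P n
      · apply ChainComplex.exactAt_succ_single_obj⟩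

end CategoryTheory.ProjectiveResolution

/-- If the kernel of a surjection from a projective module onto `M` has projective dimension `< t`, then `M` has
projective dimension `< t + 1`. -/
lemma HasProjDimLT.of_ker {R : Type u} [CommRing R] {F M : Type u}
    [AddCommGroup F] [Module R F] [AddCommGroup M] [Module R M] [Module.Projective R F]
    {g : F →ₗ[R] M} (hg : Function.Surjective g) {t : ℕ} (h : HasProjDimLT R (LinearMap.ker g) t) :
    HasProjDimLT R M (t + 1) := by
  obtain ⟨P, hP⟩ := h
  have : Projective g.shortComplexKer.X₂ := inferInstanceAs (Projective (ModuleCat.of R F))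
  refine ⟨ProjectiveResolution.splice (LinearMap.shortExact_shortComplexKer hg) P, fun i hi ↦ ?_⟩
  match i with
  | 0 => omega
  | i + 1 => exact hP i (by omega)

lemma HasProjDimLT.of_projective {R : Type u} [CommRing R] {M : Type u} [AddCommGroup M]
    [Module R M] [Module.Projective R M] {t : ℕ} (ht : 1 ≤ t) : HasProjDimLT R M t :=
  have : Projective (ModuleCat.of R M) := inferInstance
  ⟨ProjectiveResolution.self _, fun i hi ↦
    HomologicalComplex.isZero_single_obj_X _ _ _ _ (by omega)⟩

/-! ### Dimension shifting for `Tor` in the first variable -/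

section Tor

open MonoidalCategory Limits

namespace CategoryTheory.ProjectiveResolution

lemma mapHomologicalComplex_app_comp_fromLeftDerivedZero' {C D : Type*} [Category* C] [Abelian C]
    [Category* D] [Abelian D] {F G : C ⥤ D} [F.Additive] [G.Additive] (α : F ⟶ G) {X : C}
    (P : ProjectiveResolution X) :
    HomologicalComplex.opcyclesMap ((NatTrans.mapHomologicalComplex α _).app P.complex) 0 ≫
      P.fromLeftDerivedZero' G = P.fromLeftDerivedZero' F ≫ α.app X := by
  simp only [← cancel_epi (HomologicalComplex.pOpcycles _ _),
    HomologicalComplex.p_opcyclesMap_assoc,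
    pOpcycles_comp_fromLeftDerivedZero', pOpcycles_comp_fromLeftDerivedZero'_assoc]
  exact (α.naturality (P.π.f 0)).symm

end CategoryTheory.ProjectiveResolution

variable {R : Type u} [CommRing R]

/-- The complex `A ⊗ Q`. -/
noncomputable abbrev tensorComplex (A : ModuleCat.{u} R) {N : ModuleCat.{u} R}
    (Q : ProjectiveResolution N) : ChainComplex (ModuleCat.{u} R) ℕ :=
  (((tensoringLeft (ModuleCat.{u} R)).obj A).mapHomologicalComplex _).obj Q.complex

/-- The short complex `S ⊗ Q` of chain complexes. -/
noncomputable abbrev tensorShortComplex (S : ShortComplex (ModuleCat.{u} R)) {N : ModuleCat.{u} R}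
    (Q : ProjectiveResolution N) : ShortComplex (ChainComplex (ModuleCat.{u} R) ℕ) :=
  ShortComplex.mk
    (X₁ := tensorComplex S.X₁ Q) (X₂ := tensorComplex S.X₂ Q) (X₃ := tensorComplex S.X₃ Q)
    ((NatTrans.mapHomologicalComplex ((tensoringLeft (ModuleCat.{u} R)).map S.f) _).app Q.complex)
    ((NatTrans.mapHomologicalComplex ((tensoringLeft (ModuleCat.{u} R)).map S.g) _).app Q.complex)
    (by
      ext1 n
      change S.f ▷ _ ≫ S.g ▷ _ = 0
      rw [← comp_whiskerRight, S.zero, MonoidalPreadditive.zero_whiskerRight])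

lemma tensorShortComplex_shortExact {S : ShortComplex (ModuleCat.{u} R)} (hS : S.ShortExact)
    {N : ModuleCat.{u} R} (Q : ProjectiveResolution N) : (tensorShortComplex S Q).ShortExact := by
  apply HomologicalComplex.shortExact_of_degreewise_shortExact
  intro i
  have : Module.Flat R (Q.complex.X i) := by
    have : Module.Projective R (Q.complex.X i) := inferInstance
    infer_instance
  exact hS.map_of_exact (tensorRight (Q.complex.X i))

lemma isZero_homology_tensorComplex_succ (F : ModuleCat.{u} R) [Module.Flat R F]
    {N : ModuleCat.{u} R} (Q : ProjectiveResolution N) (n : ℕ) :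
    IsZero ((tensorComplex F Q).homology (n + 1)) := by
  rw [← HomologicalComplex.exactAt_iff_isZero_homology]
  exact (Q.complex_exactAt_succ n).map (tensorLeft F)

lemma torIsZero_iff {M N : Type u} [AddCommGroup M] [Module R M]
    [AddCommGroup N] [Module R N] (Q : ProjectiveResolution (ModuleCat.of R N)) (n : ℕ) :
    TorIsZero R M N n ↔ IsZero ((tensorComplex (ModuleCat.of R M) Q).homology n) := by
  rw [TorIsZero, ← ModuleCat.isZero_iff_subsingleton]
  exact (Q.isoLeftDerivedObj ((tensoringLeft (ModuleCat.{u} R)).obj (ModuleCat.of R M)) n).isZero_iff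

lemma TorIsZero.ker {F M N : Type u} [AddCommGroup M] [Module R M]
    [AddCommGroup N] [Module R N] [AddCommGroup F] [Module R F] [Module.Flat R F]
    {g : F →ₗ[R] M} (hg : Function.Surjective g) {n : ℕ} (h : TorIsZero R M N (n + 2)) :
    TorIsZero R (LinearMap.ker g) N (n + 1) := by
  let Q := projectiveResolution (ModuleCat.of R N)
  rw [torIsZero_iff Q] at h ⊢
  have hS := tensorShortComplex_shortExact (LinearMap.shortExact_shortComplexKer hg) Q
  exact h.of_iso (hS.δIso (n + 2) (n + 1) (by simp)
    (isZero_homology_tensorComplex_succ (.of R F) Q _)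
    (isZero_homology_tensorComplex_succ (.of R F) Q _)).symm

lemma TorIsZero.rTensor_injective {F M N : Type u} [AddCommGroup M] [Module R M]
    [AddCommGroup N] [Module R N] [AddCommGroup F] [Module R F]
    {g : F →ₗ[R] M} (hg : Function.Surjective g) (h : TorIsZero R M N 1) :
    Function.Injective ((LinearMap.ker g).subtype.rTensor N) := by
  let Q := projectiveResolution (ModuleCat.of R N)
  rw [torIsZero_iff Q] at h
  have hS := tensorShortComplex_shortExact (LinearMap.shortExact_shortComplexKer hg) Q
  have h0 : Mono (HomologicalComplex.homologyMap (tensorShortComplex g.shortComplexKer Q).f 0) :=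
    (hS.homology_exact₁ 1 0 (by simp)).mono_g (h.eq_of_src _ _)
  let α := (tensoringLeft (ModuleCat.{u} R)).map g.shortComplexKer.f
  have h1 : Mono (HomologicalComplex.opcyclesMap
      (tensorShortComplex g.shortComplexKer Q).f 0) := by
    exact mono_of_comm_isIso (HomologicalComplex.homologyι_naturality
      (tensorShortComplex g.shortComplexKer Q).f 0)
  have h2 : Mono (α.app (ModuleCat.of R N)) := by
    have := h1
    exact mono_of_comm_isIso (Q.mapHomologicalComplex_app_comp_fromLeftDerivedZero' α)
  exact (ModuleCat.mono_iff_injective _).mp h2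

lemma TorIsZero.subsingleton_tensorProduct {M N : Type u} [AddCommGroup M] [Module R M]
    [AddCommGroup N] [Module R N] (h : TorIsZero R M N 0) :
    Subsingleton (TensorProduct R M N) := by
  rw [TorIsZero, ← ModuleCat.isZero_iff_subsingleton] at h
  have := h.of_iso (((tensoringLeft (ModuleCat.{u} R)).obj
    (ModuleCat.of R M)).leftDerivedZeroIsoSelf.app (ModuleCat.of R N)).symm
  exact ModuleCat.isZero_iff_subsingleton.mp this

end Tor

/-- If `Tor_{n+1}(M, N) = Tor_{n+2}(M, N) = 0` for a Burch submodule `N`, then `M` has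
projective dimension at most `n + 1`. -/
lemma Submodule.IsBurch.hasProjDimLT {R : Type u} [CommRing R] [IsNoetherianRing R]
    [IsLocalRing R] {X : Type u} [AddCommGroup X] [Module R X] {N : Submodule R X}
    (hN : N.IsBurch) (n : ℕ) :
    ∀ {M : Type u} [AddCommGroup M] [Module R M] [Module.Finite R M],
      TorIsZero R M N (n + 1) → TorIsZero R M N (n + 2) → HasProjDimLT R M (n + 2) := by
  induction n with
  | zero =>
    intro M _ _ _ h1 h2
    obtain ⟨m, p, hp⟩ := Module.Finite.exists_fin' R M
    obtain ⟨k, q, hq⟩ := Module.Finite.exists_fin' R (LinearMap.ker p)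
    have : Module.Free R (LinearMap.ker p) :=
      hN.free_of_rTensor_injective (LinearMap.exact_subtype_ker_map q) hq
        ((h2.ker hp).rTensor_injective hq) (h1.rTensor_injective hp)
    exact .of_ker hp (.of_projective le_rfl)
  | succ n ih =>
    intro M _ _ _ h1 h2
    obtain ⟨m, p, hp⟩ := Module.Finite.exists_fin' R M
    exact .of_ker hp (ih (h1.ker hp) (h2.ker hp))

/-- Over a Noetherian local ring, if `N` is a Burch submodule of a finitely
generated module `X`, `M` is finitely generated, `t ≥ 1`, and
`Tor_{t-1}^R(M, N) = Tor_t^R(M, N) = 0`, then `pd_R M < t`. -/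
theorem burch_two_consecutive_tor_vanishing
    {R : Type u} [CommRing R] [IsNoetherianRing R] [IsLocalRing R]
    {X : Type u} [AddCommGroup X] [Module R X] [Module.Finite R X]
    (N : Submodule R X) (hN : N.IsBurch)
    {M : Type u} [AddCommGroup M] [Module R M] [Module.Finite R M]
    (t : ℕ) (ht : 1 ≤ t)
    (h1 : TorIsZero R M (↥N) (t - 1)) (h2 : TorIsZero R M (↥N) t) :
    HasProjDimLT R M t := by
  match t with
  | 1 =>
    have := h1.subsingleton_tensorProduct
    have : Subsingleton M := hN.subsingleton_of_tensorProduct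
    exact .of_projective le_rfl
  | n + 2 => exact hN.hasProjDimLT n h1 h2
end

section
/- Let (R,m,k) be a commutative Noetherian local ring, let X be a finitely generated R-module and let N be a Burch submodule of X. If M is a finitely generated R-module and t ≥ 1 is an integer such that Ext^t_R(M, N) = 0 and Ext^{t+1}_R(M, N) = 0, then the projective dimension of M is strictly less than t. -/
open CategoryTheory

universe u

open IsLocalRing

/-- A finite module over a local ring is the image of a finite free module under a map whose
kernel has all coordinates in the maximal ideal. -/
theorem IsLocalRing.exists_minimal_free_cover (R : Type u) [CommRing R] [IsLocalRing R]
    (M : Type u) [AddCommGroup M] [Module R M] [Module.Finite R M] :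
    ∃ (n : ℕ) (f : (Fin n →₀ R) →ₗ[R] M), Function.Surjective f ∧
      ∀ x, f x = 0 → ∀ i, x i ∈ maximalIdeal R := by
  let b := Module.finBasis (ResidueField R) (TensorProduct R (ResidueField R) M)
  have hs : Function.Surjective (TensorProduct.mk R (ResidueField R) M 1) :=
    TensorProduct.mk_surjective R M (ResidueField R) Ideal.Quotient.mk_surjective
  choose v hv using fun i => hs (b i)
  refine ⟨_, Finsupp.linearCombination R v, ?_, fun x hx i => ?_⟩
  · rw [← LinearMap.range_eq_top, Finsupp.range_linearCombination]
    exact span_eq_top_of_tmul_eq_basis v b hv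
  · have h : Finsupp.linearCombination (ResidueField R) b
        (x.mapRange (residue R) (map_zero _)) = 0 := by
      rw [← map_zero (TensorProduct.mk R (ResidueField R) M 1), ← hx,
        Finsupp.linearCombination_apply, Finsupp.linearCombination_apply, map_finsuppSum,
        Finsupp.sum_mapRange_index (by simp)]
      refine Finsupp.sum_congr fun j _ => ?_
      rw [map_smul, hv]
      rfl
    rw [← residue_eq_zero_iff]
    simpa using DFunLike.congr_fun
      ((linearIndependent_iff.mp b.linearIndependent) _ h) i

namespace IsLocalRing.MinimalResolution

variable {R : Type u} [CommRing R] [IsLocalRing R]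

/-- The rank of a chosen minimal free cover of a finite module. -/
noncomputable def rank (M : FGModuleCat.{u} R) : ℕ :=
  (exists_minimal_free_cover R M).choose

/-- A chosen minimal free cover of a finite module. -/
noncomputable def cover (M : FGModuleCat.{u} R) : (Fin (rank M) →₀ R) →ₗ[R] M :=
  (exists_minimal_free_cover R M).choose_spec.choose

theorem cover_surjective (M : FGModuleCat.{u} R) : Function.Surjective (cover M) :=
  (exists_minimal_free_cover R M).choose_spec.choose_spec.1

theorem mem_maximalIdeal_of_cover_eq_zero {M : FGModuleCat.{u} R} {x : Fin (rank M) →₀ R}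
    (hx : cover M x = 0) (i : Fin (rank M)) : x i ∈ maximalIdeal R :=
  (exists_minimal_free_cover R M).choose_spec.choose_spec.2 x hx i

theorem rank_eq_zero (M : FGModuleCat.{u} R) [Subsingleton M] : rank M = 0 := by
  by_contra h
  have := mem_maximalIdeal_of_cover_eq_zero (M := M)
    (x := Finsupp.single ⟨0, Nat.pos_of_ne_zero h⟩ 1) (Subsingleton.elim _ _)
    ⟨0, Nat.pos_of_ne_zero h⟩
  rw [Finsupp.single_eq_same] at this
  exact (Ideal.ne_top_iff_one _).mp (maximalIdeal.isMaximal R).ne_top this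

variable [IsNoetherianRing R]

/-- The iterated syzygies of a finite module with respect to minimal free covers. -/
noncomputable def syzygy (M : FGModuleCat.{u} R) : ℕ → FGModuleCat.{u} R
  | 0 => M
  | n + 1 => FGModuleCat.of R (LinearMap.ker (cover (syzygy M n)))

/-- The inclusion of a syzygy in the preceding free module. -/
noncomputable def syzygyι (M : FGModuleCat.{u} R) (n : ℕ) :
    syzygy M (n + 1) →ₗ[R] (Fin (rank (syzygy M n)) →₀ R) :=
  (LinearMap.ker (cover (syzygy M n))).subtype

theorem syzygyι_injective (M : FGModuleCat.{u} R) (n : ℕ) :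
    Function.Injective (syzygyι M n) :=
  Submodule.subtype_injective _

theorem cover_syzygyι (M : FGModuleCat.{u} R) (n : ℕ) (x : syzygy M (n + 1)) :
    cover (syzygy M n) (syzygyι M n x) = 0 :=
  Subtype.property (p := (· ∈ LinearMap.ker (cover (syzygy M n)))) x

theorem exists_syzygyι_eq {M : FGModuleCat.{u} R} {n : ℕ} {x : Fin (rank (syzygy M n)) →₀ R}
    (hx : cover (syzygy M n) x = 0) : ∃ y, syzygyι M n y = x :=
  ⟨(⟨x, hx⟩ : LinearMap.ker (cover (syzygy M n))), rfl⟩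

/-- The differential of the minimal free resolution. -/
noncomputable def differential (M : FGModuleCat.{u} R) (n : ℕ) :
    (Fin (rank (syzygy M (n + 1))) →₀ R) →ₗ[R] (Fin (rank (syzygy M n)) →₀ R) :=
  syzygyι M n ∘ₗ cover (syzygy M (n + 1))

theorem exact_differential_cover (M : FGModuleCat.{u} R) (n : ℕ) :
    Function.Exact (differential M n) (cover (syzygy M n)) := by
  refine fun x => ⟨fun hx => ?_, ?_⟩
  · obtain ⟨y, rfl⟩ := exists_syzygyι_eq hx
    obtain ⟨z, rfl⟩ := cover_surjective _ y
    exact ⟨z, rfl⟩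
  · rintro ⟨z, rfl⟩
    exact cover_syzygyι M n _

theorem exact_differential (M : FGModuleCat.{u} R) (n : ℕ) :
    Function.Exact (differential M (n + 1)) (differential M n) := by
  intro x
  rw [← exact_differential_cover M (n + 1) x]
  exact map_eq_zero_iff _ (syzygyι_injective M n)

theorem differential_apply_mem (M : FGModuleCat.{u} R) (n : ℕ)
    (x : Fin (rank (syzygy M (n + 1))) →₀ R) (i : Fin (rank (syzygy M n))) :
    differential M n x i ∈ maximalIdeal R :=
  mem_maximalIdeal_of_cover_eq_zero (cover_syzygyι M n _) i

theorem rank_syzygy_succ_eq_zero {M : FGModuleCat.{u} R} {n : ℕ}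
    (h : rank (syzygy M n) = 0) : rank (syzygy M (n + 1)) = 0 := by
  have : IsEmpty (Fin (rank (syzygy M n))) := by rw [h]; infer_instance
  have : Subsingleton (syzygy M (n + 1)) := (syzygyι_injective M n).subsingleton
  exact rank_eq_zero _

/-- The underlying complex of the minimal free resolution. -/
noncomputable def complex (M : FGModuleCat.{u} R) : ChainComplex (ModuleCat.{u} R) ℕ :=
  ChainComplex.of (fun n => ModuleCat.of R (Fin (rank (syzygy M n)) →₀ R))
    (fun n => ModuleCat.ofHom (differential M n)) fun n => by
      ext1
      exact (exact_differential M n).linearMap_comp_eq_zero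

theorem complex_d (M : FGModuleCat.{u} R) (n : ℕ) :
    (complex M).d (n + 1) n = ModuleCat.ofHom (differential M n) :=
  ChainComplex.of_d (fun n => ModuleCat.of R (Fin (rank (syzygy M n)) →₀ R))
    (fun n => ModuleCat.ofHom (differential M n)) n

theorem exactAt_complex_succ (M : FGModuleCat.{u} R) (n : ℕ) :
    (complex M).ExactAt (n + 1) := by
  rw [HomologicalComplex.exactAt_iff' _ (n + 2) (n + 1) n (by simp) (by simp),
    ShortComplex.ShortExact.moduleCat_exact_iff_function_exact]
  dsimp [HomologicalComplex.sc', HomologicalComplex.shortComplexFunctor']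
  rw [complex_d, complex_d]
  exact exact_differential M n

/-- The minimal free resolution of a finite module over a Noetherian local ring. -/
noncomputable def resolution (M : FGModuleCat.{u} R) :
    ProjectiveResolution (ModuleCat.of R M) where
  complex := complex M
  projective n := ModuleCat.projective_of_free (Finsupp.basisSingleOne (R := R))
  π := (ChainComplex.toSingle₀Equiv _ _).symm ⟨ModuleCat.ofHom (cover M), by
    rw [complex_d]
    ext1
    exact (exact_differential_cover M 0).linearMap_comp_eq_zero⟩
  quasiIso := ⟨fun n => by
    cases n
    · rw [ChainComplex.quasiIsoAt₀_iff, ShortComplex.quasiIso_iff_of_zeros']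
      · dsimp
        let S : ShortComplex (ModuleCat.{u} R) :=
          ShortComplex.mk (ModuleCat.ofHom (differential M 0)) (ModuleCat.ofHom (cover M))
            (by ext1; exact (exact_differential_cover M 0).linearMap_comp_eq_zero)
        refine (ShortComplex.exact_and_epi_g_iff_of_iso (S₂ := S) ?_).2
          ⟨(ShortComplex.ShortExact.moduleCat_exact_iff_function_exact _).2
            (exact_differential_cover M 0),
            (ModuleCat.epi_iff_surjective _).2 (cover_surjective M)⟩
        exact ShortComplex.isoMk (Iso.refl _) (Iso.refl _) (Iso.refl _)
          (by simp [complex_d]; rfl) (by simp; rfl)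
      all_goals rfl
    · rw [quasiIsoAt_iff_exactAt']
      · apply exactAt_complex_succ
      · apply ChainComplex.exactAt_succ_single_obj⟩

end IsLocalRing.MinimalResolution

theorem ExtIsZero.exists_comp_eq {R : Type u} [CommRing R] {M N : Type u} [AddCommGroup M]
    [Module R M] [AddCommGroup N] [Module R N] {n : ℕ} (h : ExtIsZero R M N (n + 1))
    (P : ProjectiveResolution (ModuleCat.of R M)) (f : P.complex.X (n + 1) ⟶ ModuleCat.of R N)
    (hf : P.complex.d (n + 2) (n + 1) ≫ f = 0) :
    ∃ g : P.complex.X n ⟶ ModuleCat.of R N, P.complex.d (n + 1) n ≫ g = f := by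
  have hz := (ModuleCat.isZero_of_iff_subsingleton.2 h).of_iso
    (P.isoExt (R := R) (n + 1) (ModuleCat.of R N)).symm
  rw [← HomologicalComplex.exactAt_iff_isZero_homology,
    HomologicalComplex.exactAt_iff' _ n (n + 1) (n + 2) (by simp) (by simp),
    ShortComplex.moduleCat_exact_iff] at hz
  exact hz f hf

open IsLocalRing

/-- Let `d₂ : F₂ → F₁`, `d₁ : F₁ → F` and `d₀ : F → G` be maps with `F ≠ 0` and `G` free, the images
of `d₁` and `d₀` having coordinates in `𝔪`, and `d₁ ∘ d₂ = 0`. If maps `F₁ → N` killing `d₂` factor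
through `d₁` and maps `F → N` killing `d₁` factor through `d₀`, then `𝔪 • (N :_X 𝔪) ≤ 𝔪 • N`. -/
theorem Submodule.smul_colonBy_le_smul {R X : Type u} [CommRing R] [IsLocalRing R]
    [AddCommGroup X] [Module R X] (N : Submodule R X) {F₂ F₁ ι κ : Type*}
    [AddCommGroup F₂] [Module R F₂] [AddCommGroup F₁] [Module R F₁]
    (d₂ : F₂ →ₗ[R] F₁) (d₁ : F₁ →ₗ[R] (ι →₀ R)) (d₀ : (ι →₀ R) →ₗ[R] (κ →₀ R))
    (hd : d₁ ∘ₗ d₂ = 0) (h₁ : ∀ y i, d₁ y i ∈ maximalIdeal R)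
    (h₀ : ∀ y i, d₀ y i ∈ maximalIdeal R) (i : ι)
    (e₁ : ∀ f : F₁ →ₗ[R] N, f ∘ₗ d₂ = 0 → ∃ g : (ι →₀ R) →ₗ[R] N, g ∘ₗ d₁ = f)
    (e₀ : ∀ f : (ι →₀ R) →ₗ[R] N, f ∘ₗ d₁ = 0 → ∃ g : (κ →₀ R) →ₗ[R] N, g ∘ₗ d₀ = f) :
    maximalIdeal R • N.colonBy (maximalIdeal R) ≤ maximalIdeal R • N := by
  refine Submodule.smul_le.2 fun a ha x hx => ?_
  let φ : (ι →₀ R) →ₗ[R] X := (LinearMap.toSpanSingleton R X x) ∘ₗ Finsupp.lapply i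
  have hφ (y : ι →₀ R) : φ y = y i • x := rfl
  obtain ⟨ψ, hψ⟩ := e₁ ((φ ∘ₗ d₁).codRestrict N fun y => hx _ (h₁ y i)) <| by
    ext y
    change φ ((d₁ ∘ₗ d₂) y) = 0
    rw [hd, LinearMap.zero_apply, map_zero]
  have hψ' (y : F₁) : (ψ (d₁ y) : X) = φ (d₁ y) := congrArg Subtype.val (LinearMap.congr_fun hψ y)
  obtain ⟨θ, hθ⟩ := e₀ ((a • φ).codRestrict N (fun y => by
      rw [LinearMap.smul_apply, hφ, smul_comm]
      exact N.smul_mem _ (hx a ha)) - a • ψ) <| by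
    ext y
    simp [hψ']
  have hθ' : (θ (d₀ (Finsupp.single i 1)) : X) = a • x - a • (ψ (Finsupp.single i 1) : X) := by
    simpa [hφ] using congrArg Subtype.val (LinearMap.congr_fun hθ (Finsupp.single i 1))
  rw [← sub_add_cancel (a • x) (a • (ψ (Finsupp.single i 1) : X)), ← hθ']
  refine add_mem ?_ (Submodule.smul_mem_smul ha (ψ _).2)
  rw [← Finsupp.sum_single (d₀ (Finsupp.single i 1)), Finsupp.sum, map_sum,
    AddSubmonoidClass.coe_finsetSum]
  refine sum_mem fun j _ => ?_
  rw [← mul_one (d₀ (Finsupp.single i 1) j), ← smul_eq_mul, ← Finsupp.smul_single, map_smul]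
  exact Submodule.smul_mem_smul (h₀ _ j) (θ _).2

theorem Submodule.smul_le_smul_colonBy {R X : Type u} [CommRing R] [AddCommGroup X] [Module R X]
    (N : Submodule R X) (I : Ideal R) : I • N ≤ I • N.colonBy I :=
  Submodule.smul_mono le_rfl fun _ hx r _ => N.smul_mem r hx

open IsLocalRing.MinimalResolution in
/-- Over a Noetherian local ring, if `N` is a Burch submodule of a finitely
generated module `X`, `M` is finitely generated, `t ≥ 1`, and
`Ext^t_R(M, N) = Ext^{t+1}_R(M, N) = 0`, then `pd_R M < t`. -/
theorem burch_two_consecutive_ext_vanishing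
    {R : Type u} [CommRing R] [IsNoetherianRing R] [IsLocalRing R]
    {X : Type u} [AddCommGroup X] [Module R X] [Module.Finite R X]
    (N : Submodule R X) (hN : N.IsBurch)
    {M : Type u} [AddCommGroup M] [Module R M] [Module.Finite R M]
    (t : ℕ) (ht : 1 ≤ t)
    (h1 : ExtIsZero R M (↥N) t) (h2 : ExtIsZero R M (↥N) (t + 1)) :
    HasProjDimLT R M t := by
  obtain ⟨n, rfl⟩ : ∃ n, t = n + 1 := ⟨t - 1, (Nat.sub_add_cancel ht).symm⟩
  let K := FGModuleCat.of R M
  let P : ProjectiveResolution (ModuleCat.of R M) := resolution K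
  have ext_comp {q : ℕ} (h : ExtIsZero R M N (q + 1))
      (f : (Fin (rank (syzygy K (q + 1))) →₀ R) →ₗ[R] N)
      (hf : f ∘ₗ differential K (q + 1) = 0) :
      ∃ g : (Fin (rank (syzygy K q)) →₀ R) →ₗ[R] N, g ∘ₗ differential K q = f := by
    obtain ⟨g, hg⟩ := h.exists_comp_eq P (ModuleCat.ofHom f) (by
      change (complex K).d _ _ ≫ _ = 0
      rw [complex_d]
      ext1
      exact hf)
    change (complex K).d _ _ ≫ g = _ at hg
    rw [complex_d] at hg
    exact ⟨g.hom, congrArg ModuleCat.Hom.hom hg⟩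
  have hrank : rank (syzygy K (n + 1)) = 0 := by
    by_contra h
    refine hN (le_antisymm ?_ (N.smul_le_smul_colonBy _))
    exact N.smul_colonBy_le_smul (differential K (n + 2)) (differential K (n + 1))
      (differential K n) (exact_differential K (n + 1)).linearMap_comp_eq_zero
      (differential_apply_mem K (n + 1)) (differential_apply_mem K n)
      ⟨0, Nat.pos_of_ne_zero h⟩ (ext_comp h2) (ext_comp h1)
  refine ⟨P, fun i hi => ?_⟩
  have hi' : rank (syzygy K i) = 0 := by
    induction i, hi using Nat.le_induction with
    | base => exact hrank
    | succ i _ ih => exact rank_syzygy_succ_eq_zero ih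
  have : IsEmpty (Fin (rank (syzygy K i))) := by rw [hi']; infer_instance
  change Limits.IsZero (ModuleCat.of R (Fin (rank (syzygy K i)) →₀ R))
  exact ModuleCat.isZero_of_subsingleton _
end
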